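/- Let H ≤ S_n be semiregular with orbit transversal R, and let h ∈ H. Then the map A_h : 𝔠_n → 𝔠_n is a homeomorphism of the Cantor space 𝔠_n, and its inverse B is given recursively by: the first letter of B(χ) is χ_1·h^{-1}, and for each k ≥ 1 the (k+1)-st letter of B(χ) is χ_{k+1}·(h_{y_k})^{-1}, where y_k denotes the k-th letter of B(χ). -/

import Mathlib

open scoped Classical Pointwise

/-- The `n`-ary Cantor space: infinite sequences over an `n`-letter alphabet. -/
abbrev Cantor (n : ℕ) := ℕ → Fin n

/-- Prefix a sequence by a finite word. -/
def appendWord {n : ℕ} (θ : List (Fin n)) (x : Cantor n) : Cantor n :=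
  fun i => if h : i < θ.length then θ.get ⟨i, h⟩ else x (i - θ.length)

/-- `x` lies in the cone `[θ]`, i.e. has `θ` as a prefix. -/
def inCone {n : ℕ} (θ : List (Fin n)) (x : Cantor n) : Prop :=
  ∀ i, (h : i < θ.length) → x i = θ.get ⟨i, h⟩

/-- A permutation group is semiregular if no nontrivial element has a fixed point. -/
def Semiregular {n : ℕ} (G : Subgroup (Equiv.Perm (Fin n))) : Prop :=
  ∀ g ∈ G, (∃ x, g x = x) → g = 1

/-- `R` is an orbit transversal for the natural action of `H ≤ S_n` on the `n`
points: it contains exactly one point of each `H`-orbit. -/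
def IsTransversal {n : ℕ} (H : Subgroup (Equiv.Perm (Fin n))) (R : Set (Fin n)) : Prop :=
  ∀ x : Fin n, ∃! r, r ∈ R ∧ ∃ h ∈ H, h x = r

/-- `hmap` assigns to each letter `i` the (unique) element `h_i` of `H` with
`i ⬝ h_i ∈ R`. -/
def IsHmap {n : ℕ} (H : Subgroup (Equiv.Perm (Fin n))) (R : Set (Fin n))
    (hmap : Fin n → Equiv.Perm (Fin n)) : Prop :=
  ∀ i : Fin n, hmap i ∈ H ∧ hmap i i ∈ R

/-- The transducer map `A_h` on the Cantor space: the first letter is moved by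
`h`, and each subsequent letter `x_{k+1}` is moved by `h_{x_k}` (here `hmap i`
plays the role of `h_i`). -/
def AFun {n : ℕ} (h : Equiv.Perm (Fin n)) (hmap : Fin n → Equiv.Perm (Fin n))
    (x : Cantor n) : Cantor n
  | 0 => h (x 0)
  | k + 1 => hmap (x k) (x (k + 1))

/-- The recursively defined inverse of the transducer map `A_h`: the first
letter of `B χ` is `χ_1 ⬝ h⁻¹`, and its `(k+1)`-st letter is
`χ_{k+1} ⬝ (h_{y_k})⁻¹` where `y_k` is the `k`-th letter of `B χ`. -/
def BFun {n : ℕ} (h : Equiv.Perm (Fin n)) (hmap : Fin n → Equiv.Perm (Fin n))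
    (x : Cantor n) : ℕ → Fin n
  | 0 => h⁻¹ (x 0)
  | k + 1 => (hmap (BFun h hmap x k))⁻¹ (x (k + 1))

/-- Let `H ≤ S_n` be semiregular with orbit transversal `R` and
let `h ∈ H`.  Then the transducer map `A_h` is a homeomorphism of the Cantor
space, with inverse the recursively defined map `B = BFun h hmap`. -/
theorem transducer_isHomeomorph (n : ℕ)
    (H : Subgroup (Equiv.Perm (Fin n))) (hH : Semiregular H)
    (R : Set (Fin n)) (hR : IsTransversal H R)
    (hmap : Fin n → Equiv.Perm (Fin n)) (hhmap : IsHmap H R hmap)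
    (h : Equiv.Perm (Fin n)) (hh : h ∈ H) :
    IsHomeomorph (AFun h hmap) ∧
      (∀ x : Cantor n, BFun h hmap (AFun h hmap x) = x) ∧
      (∀ x : Cantor n, AFun h hmap (BFun h hmap x) = x) := by
  have hBA : ∀ x : Cantor n, BFun h hmap (AFun h hmap x) = x := by
    intro x
    funext k
    induction k with
    | zero => simp [BFun, AFun]
    | succ k ih => simp [BFun, AFun, ih]
  have hAB : ∀ x : Cantor n, AFun h hmap (BFun h hmap x) = x := by
    intro x
    funext k
    cases k with
    | zero => simp [BFun, AFun]
    | succ k => simp [BFun, AFun]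
  refine ⟨?_, hBA, hAB⟩
  rw [isHomeomorph_iff_continuous_bijective]
  refine ⟨?_, Function.LeftInverse.injective hBA, Function.RightInverse.surjective hAB⟩
  refine continuous_pi fun k => ?_
  cases k with
  | zero => exact (continuous_of_discreteTopology (f := fun a => h a)).comp (continuous_apply 0)
  | succ k =>
    have h1 : Continuous (fun x : Cantor n => (x k, x (k + 1))) :=
      (continuous_apply k).prodMk (continuous_apply (k + 1))
    have h2 : Continuous (fun p : Fin n × Fin n => hmap p.1 p.2) :=
      continuous_of_discreteTopology
    exact h2.comp h1
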